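/- Let R_n be the sprout sequence with seed F(t), log F(t) = ∑ b_n t^n/n. For i, j ≥ 1 with i + j = n and i ≠ j, the coefficient of h_i h_j in the h-expansion of R_n equals b_i b_j − b_n; if i = j = n/2, it equals (b_i^2 − b_n)/2. -/

import Mathlib

/- Symmetric functions in infinitely many variables `x₁, x₂, …` are modelled as
elements of `MvPowerSeries ℕ K`. A sprout sequence with seed
`F(t) = ∑ aₙ tⁿ` (`a₀ = 1`) is defined by `∑ₙ Rₙ tⁿ = ∏ᵢ F(xᵢ t)`; since `Rₙ` is
homogeneous of degree `n`, the variable `t` is recorded by the total degree, and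
the product `∏ᵢ F(xᵢ t)` is the power series whose coefficient on the monomial
`∏ᵢ xᵢ^{dᵢ}` is `∏ᵢ a_{dᵢ}`. -/

open Finset

noncomputable section

variable {K : Type*} [Field K] [CharZero K]

/-- Total degree of a monomial exponent vector. -/
def mdeg (d : ℕ →₀ ℕ) : ℕ := d.sum fun _ k => k

/-- The infinite product `∏_{i≥1} F(x_i t)` where `F(t) = ∑ aₙ tⁿ`: the
coefficient of `∏ xᵢ^{dᵢ}` is `∏ a_{dᵢ}`. -/
def sproutSeries (a : ℕ → K) : MvPowerSeries ℕ K :=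
  fun d => d.prod fun _ k => a k

/-- `sproutFn a n` is `Rₙ`, the degree-`n` homogeneous component of `∏ᵢ F(xᵢ t)`,
so that `∑ₙ (sproutFn a n) tⁿ = ∏ᵢ F(xᵢ t)`. -/
def sproutFn (a : ℕ → K) (n : ℕ) : MvPowerSeries ℕ K :=
  fun d => if mdeg d = n then sproutSeries a d else 0

/-- The multiset of nonzero exponents of a monomial. -/
def typeOf (d : ℕ →₀ ℕ) : Multiset ℕ := d.support.val.map d

/-- The monomial symmetric function `m_μ` (in infinitely many variables). -/
def msym (K : Type*) [Field K] (μ : Multiset ℕ) : MvPowerSeries ℕ K :=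
  fun d => if typeOf d = μ then 1 else 0

/-- The power sum symmetric function `p_k`. -/
def psym (K : Type*) [Field K] (k : ℕ) : MvPowerSeries ℕ K := msym K {k}

/-- `p_μ = p_{μ₁} p_{μ₂} ⋯`. -/
def pprod (K : Type*) [Field K] (μ : Multiset ℕ) : MvPowerSeries ℕ K :=
  (μ.map (psym K)).prod

/-- The complete homogeneous symmetric function `h_n`. -/
def hsym (K : Type*) [Field K] (n : ℕ) : MvPowerSeries ℕ K :=
  fun d => if mdeg d = n then 1 else 0

/-- `h_μ = h_{μ₁} h_{μ₂} ⋯`. -/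
def hprod (K : Type*) [Field K] (μ : Multiset ℕ) : MvPowerSeries ℕ K :=
  (μ.map (hsym K)).prod

/-- The elementary symmetric function `e_n`. -/
def esym (K : Type*) [Field K] (n : ℕ) : MvPowerSeries ℕ K :=
  msym K (Multiset.replicate n 1)

/-- `e_μ = e_{μ₁} e_{μ₂} ⋯`. -/
def eprod (K : Type*) [Field K] (μ : Multiset ℕ) : MvPowerSeries ℕ K :=
  (μ.map (esym K)).prod

/-- `z_λ = ∏ᵢ i^{mᵢ} mᵢ!` where `λ` has `mᵢ` parts equal to `i`. -/
def zPart (μ : Multiset ℕ) : ℕ :=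
  μ.prod * (μ.dedup.map fun i => (μ.count i).factorial).prod

/-- The parts of a partition arranged in weakly decreasing order. -/
def plist (μ : Multiset ℕ) : List ℕ := (μ.sort (· ≤ ·)).reverse

/-- `h_m` for an integer index, with `h_m = 0` for `m < 0`. -/
def hsymZ (K : Type*) [Field K] (m : ℤ) : MvPowerSeries ℕ K :=
  if 0 ≤ m then hsym K m.toNat else 0

/-- The Schur function `s_λ`, via the Jacobi–Trudi determinant `det[h_{λᵢ-i+j}]`,
where `l` is the weakly decreasing list of parts of `λ`. -/
def sschur (K : Type*) [Field K] (l : List ℕ) : MvPowerSeries ℕ K :=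
  Matrix.det (Matrix.of fun i j : Fin l.length =>
    hsymZ K ((l.get i : ℤ) - (i : ℤ) + (j : ℤ)))

/-- `a_m` for an integer index, with `a_m = 0` for `m < 0`. -/
def aZ (a : ℕ → K) (m : ℤ) : K := if 0 ≤ m then a m.toNat else 0

/-- The partition `⟨1ⁿ⟩` of `n`. -/
def onePartition (n : ℕ) : Nat.Partition n :=
  ⟨Multiset.replicate n 1, by
    intro i hi
    rw [Multiset.eq_of_mem_replicate hi]
    exact Nat.one_pos, by simp [Multiset.sum_replicate]⟩

/-- The partition of `i + j` with the two parts `i, j` (`i, j ≥ 1`). -/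
def twoPartition (i j : ℕ) (hi : 0 < i) (hj : 0 < j) : Nat.Partition (i + j) :=
  ⟨{i, j}, by
    intro k hk
    rcases Multiset.mem_cons.mp hk with h | h
    · exact h ▸ hi
    · rw [Multiset.mem_singleton.mp h]; exact hj, by simp⟩

set_option linter.unusedSectionVars false

theorem injective_of_surjective_ringHom_endomorphism {B : Type*} [CommRing B] [IsNoetherianRing B]
    (f : B →+* B) (hf : Function.Surjective f) : Function.Injective f := by
  let g : ℕ →o Ideal B :=
    { toFun := fun n => RingHom.ker (f ^ n)
      monotone' := monotone_nat_of_le_succ fun n x hx => by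
        rw [RingHom.mem_ker] at hx ⊢
        rw [pow_succ', RingHom.mul_def, RingHom.comp_apply, hx, map_zero] }
  obtain ⟨n, hn⟩ := monotone_stabilizes_iff_noetherian.mpr ‹IsNoetherianRing B› g
  rw [injective_iff_map_eq_zero]
  intro x hx
  have hs : Function.Surjective (f ^ n) := by
    rw [RingHom.coe_pow]
    exact hf.iterate n
  obtain ⟨y, rfl⟩ := hs x
  have hy : y ∈ g (n + 1) := by
    change y ∈ RingHom.ker (f ^ (n + 1))
    rwa [RingHom.mem_ker, pow_succ', RingHom.mul_def, RingHom.comp_apply]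
  rw [← hn (n + 1) n.le_succ] at hy
  exact hy

/-- If two algebra homomorphisms out of a Noetherian ring have the same range and one of them is
injective, then so is the other. -/
theorem injective_of_range_eq {B A : Type*} [CommRing B] [IsNoetherianRing B] [CommRing A]
    [Algebra K B] [Algebra K A] (f g : B →ₐ[K] A) (hf : Function.Injective f)
    (hfg : f.range = g.range) : Function.Injective g := by
  have hmem : ∀ x, ∃ y, f y = g x := fun x => by
    have hx : g x ∈ f.range := hfg ▸ AlgHom.mem_range_self g x
    exact hx
  let u : B →ₐ[K] B := (AlgEquiv.ofInjective f hf).symm.toAlgHom.comp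
    (g.codRestrict f.range hmem)
  have hu : ∀ x, f (u x) = g x := fun x =>
    congrArg Subtype.val ((AlgEquiv.ofInjective f hf).apply_symm_apply ⟨g x, hmem x⟩)
  have hus : Function.Surjective u := fun y => by
    have hy : f y ∈ g.range := hfg ▸ AlgHom.mem_range_self f y
    obtain ⟨x, hx⟩ := hy
    exact ⟨x, hf ((hu x).trans hx)⟩
  have hui := injective_of_surjective_ringHom_endomorphism (u : B →+* B) hus
  intro x y hxy
  exact hui (hf (by simpa [hu] using hxy))

/-- `IsNewton N b p f` says that `k fₖ = ∑_{l=1}^k bₗ pₗ fₖ₋ₗ` for all `k ≤ N`. -/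
def IsNewton {A : Type*} [CommRing A] [Algebra K A] (N : ℕ) (b : ℕ → K) (p f : ℕ → A) : Prop :=
  ∀ k ≤ N, (k : K) • f k = ∑ l ∈ Finset.Icc 1 k, b l • (p l * f (k - l))

theorem IsNewton.mem {A : Type*} [CommRing A] [Algebra K A] {N : ℕ} {b : ℕ → K} {p f : ℕ → A}
    (h : IsNewton N b p f) (S : Subalgebra K A) (h0 : f 0 ∈ S)
    (hp : ∀ k, 1 ≤ k → k ≤ N → p k ∈ S) : ∀ k ≤ N, f k ∈ S := by
  intro k
  induction k using Nat.strong_induction_on with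
  | _ k ih =>
    intro hk
    rcases Nat.eq_zero_or_pos k with rfl | hpos
    · exact h0
    have hk0 : (k : K) ≠ 0 := Nat.cast_ne_zero.mpr hpos.ne'
    have hfk : f k = (k : K)⁻¹ • ((k : K) • f k) := by rw [smul_smul, inv_mul_cancel₀ hk0, one_smul]
    rw [hfk, h k hk]
    refine S.smul_mem (S.sum_mem fun l hl => S.smul_mem (S.mul_mem ?_ ?_) _) _
    · rw [Finset.mem_Icc] at hl
      exact hp l hl.1 (hl.2.trans hk)
    · rw [Finset.mem_Icc] at hl
      exact ih _ (by omega) (by omega)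

theorem IsNewton.eq_sub {A : Type*} [CommRing A] [Algebra K A] {N : ℕ} {b : ℕ → K} {p f : ℕ → A}
    (h : IsNewton N b p f) (h0 : f 0 = 1) {k : ℕ} (hk1 : 1 ≤ k) (hk : k ≤ N) :
    b k • p k = (k : K) • f k - ∑ l ∈ Finset.Ico 1 k, b l • (p l * f (k - l)) := by
  rw [h k hk, ← Finset.Ico_succ_right_eq_Icc, Order.succ_eq_add_one, Finset.sum_Ico_succ_top hk1]
  simp [h0]

theorem IsNewton.mem_of_mem {A : Type*} [CommRing A] [Algebra K A] {N : ℕ} {p f : ℕ → A}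
    (h : IsNewton N (fun _ => (1 : K)) p f) (S : Subalgebra K A) (h0 : f 0 = 1)
    (hf : ∀ k ≤ N, f k ∈ S) : ∀ k, 1 ≤ k → k ≤ N → p k ∈ S := by
  intro k
  induction k using Nat.strong_induction_on with
  | _ k ih =>
    intro hk1 hk
    have := h.eq_sub h0 hk1 hk
    rw [one_smul] at this
    rw [this]
    refine S.sub_mem (S.smul_mem (hf k hk) _) (S.sum_mem fun l hl => S.smul_mem (S.mul_mem ?_ ?_) _)
    · rw [Finset.mem_Ico] at hl
      exact ih l hl.2 hl.1 (by omega)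
    · exact hf _ (by omega)

theorem isNewton_of_injective {A B : Type*} [CommRing A] [Algebra K A] [CommRing B] [Algebra K B]
    {N : ℕ} {b : ℕ → K} {p f : ℕ → A} (h : IsNewton N b p f) (g : B →ₐ[K] A)
    (hg : Function.Injective g) {q r : ℕ → B} (hq : ∀ k, 1 ≤ k → k ≤ N → g (q k) = p k)
    (hr : ∀ k ≤ N, g (r k) = f k) : IsNewton N b q r := by
  intro k hk
  apply hg
  rw [map_smul, hr k hk, h k hk, map_sum]
  refine Finset.sum_congr rfl fun l hl => ?_
  rw [Finset.mem_Icc] at hl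
  rw [map_smul, map_mul, hq l hl.1 (by omega), hr _ (by omega)]

/-- Restriction of a power series to its first `N` variables. -/
def restrictVars (K : Type*) [Field K] (N : ℕ) :
    MvPowerSeries ℕ K →ₐ[K] MvPowerSeries (Fin N) K :=
  MvPowerSeries.killCompl Fin.valEmbedding

theorem coeff_restrictVars_sproutFn {N : ℕ} (a : ℕ → K) (ha0 : a 0 = 1) (n : ℕ)
    (d : Fin N →₀ ℕ) :
    MvPowerSeries.coeff d (restrictVars K N (sproutFn a n)) =
      if ∑ m, d m = n then ∏ m, a (d m) else 0 := by
  rw [restrictVars, MvPowerSeries.coeff_killCompl]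
  change (if mdeg _ = n then sproutSeries a _ else 0) = _
  rw [mdeg, sproutSeries, Finsupp.sum_embDomain, Finsupp.prod_embDomain,
    Finsupp.sum_fintype _ _ (fun _ => rfl), Finsupp.prod_fintype _ _ (fun _ => ha0)]

theorem hsym_eq_sproutFn (n : ℕ) : hsym K n = sproutFn (fun _ => 1) n := by
  funext d
  simp [hsym, sproutFn, sproutSeries, Finsupp.prod]

theorem restrictVars_sproutFn_zero {N : ℕ} (a : ℕ → K) (ha0 : a 0 = 1) :
    restrictVars K N (sproutFn a 0) = 1 := by
  ext d
  rw [coeff_restrictVars_sproutFn a ha0, MvPowerSeries.coeff_one]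
  by_cases hd : d = 0
  · simp [hd, ha0]
  · rw [if_neg hd, if_neg]
    intro h
    exact hd (Finsupp.ext fun m => (Finset.sum_eq_zero_iff.mp h) m (Finset.mem_univ m))

/-- The power sum `x₁ᵏ + ⋯ + x_Nᵏ` as a power series. -/
def psumSeries (K : Type*) [Field K] (N k : ℕ) : MvPowerSeries (Fin N) K :=
  (MvPolynomial.psum (Fin N) K k : MvPolynomial (Fin N) K)

theorem coeff_psumSeries_mul {N k : ℕ} (f : MvPowerSeries (Fin N) K) (d : Fin N →₀ ℕ) :
    MvPowerSeries.coeff d (psumSeries K N k * f) =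
      ∑ m, if k ≤ d m then MvPowerSeries.coeff (d - Finsupp.single m k) f else 0 := by
  have hp : psumSeries K N k = ∑ m, MvPowerSeries.X m ^ k := by
    rw [psumSeries, MvPolynomial.psum, ← MvPolynomial.coeToMvPowerSeries.ringHom_apply, map_sum]
    simp
  rw [hp, Finset.sum_mul, map_sum]
  refine Finset.sum_congr rfl fun m _ => ?_
  rw [MvPowerSeries.X_pow_eq, MvPowerSeries.coeff_monomial_mul]
  simp [Finsupp.single_le_iff]

theorem isNewton_sproutFn {N : ℕ} (a b : ℕ → K) (ha0 : a 0 = 1)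
    (hb : ∀ n : ℕ, 1 ≤ n → (n : K) * a n = ∑ k ∈ Finset.Icc 1 n, b k * a (n - k)) (n : ℕ) :
    IsNewton n b (psumSeries K N) fun k => restrictVars K N (sproutFn a k) := by
  intro k _
  ext d
  simp only [map_smul, map_sum, coeff_psumSeries_mul, smul_eq_mul, coeff_restrictVars_sproutFn a ha0]
  have hsub : ∀ (m : Fin N) (l : ℕ), l ≤ d m →
      ∑ m', (d - Finsupp.single m l) m' + l = ∑ m', d m' := by
    intro m l hl
    have hle : Finsupp.single m l ≤ d := by simpa [Finsupp.single_le_iff] using hl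
    have h1 := congrArg (fun e : Fin N →₀ ℕ => ∑ m', e m') (tsub_add_cancel_of_le hle)
    simpa [Finset.sum_add_distrib, Finsupp.single_apply] using h1
  by_cases hd : ∑ m, d m = k
  · have hterm : ∀ m : Fin N, (d m : K) * ∏ m', a (d m') = ∑ l ∈ Finset.Icc 1 k,
        b l * if l ≤ d m then
          (if ∑ m', (d - Finsupp.single m l) m' = k - l then
            ∏ m', a ((d - Finsupp.single m l) m') else 0) else 0 := by
      intro m
      have hdm : d m ≤ k := hd ▸ Finset.single_le_sum (fun _ _ => Nat.zero_le _) (Finset.mem_univ m)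
      have hprod : ∏ m', a (d m') = a (d m) * ∏ m' ∈ Finset.univ.erase m, a (d m') :=
        (Finset.mul_prod_erase _ _ (Finset.mem_univ m)).symm
      have hmain : (d m : K) * a (d m) = ∑ l ∈ Finset.Icc 1 (d m), b l * a (d m - l) := by
        rcases Nat.eq_zero_or_pos (d m) with h | h
        · simp [h]
        · exact hb _ h
      rw [hprod, ← mul_assoc, hmain, Finset.sum_mul]
      rw [← Finset.sum_subset (Finset.Icc_subset_Icc_right hdm)]
      · refine Finset.sum_congr rfl fun l hl => ?_
        rw [Finset.mem_Icc] at hl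
        have := hsub m l hl.2
        rw [if_pos hl.2, if_pos (by omega), ← Finset.mul_prod_erase _ _ (Finset.mem_univ m),
          mul_assoc]
        congr 2
        · simp
        · refine Finset.prod_congr rfl fun m' hm' => ?_
          simp [(Finset.ne_of_mem_erase hm').symm]
      · intro l hl hl'
        rw [if_neg, mul_zero]
        simp only [Finset.mem_Icc] at hl hl'
        omega
    rw [if_pos hd]
    simp only [Finset.mul_sum]
    rw [Finset.sum_comm]
    simp only [← hterm]
    rw [← Finset.sum_mul, ← Nat.cast_sum, hd]
  · rw [if_neg hd, mul_zero]
    symm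
    refine Finset.sum_eq_zero fun l hl => ?_
    rw [Finset.sum_eq_zero, mul_zero]
    intro m _
    split_ifs with h1 h2
    · have := hsub m l h1
      rw [Finset.mem_Icc] at hl
      omega
    · rfl
    · rfl

theorem isNewton_hsym {N : ℕ} (n : ℕ) :
    IsNewton n (fun _ => (1 : K)) (psumSeries K N) fun k => restrictVars K N (hsym K k) := by
  simp only [hsym_eq_sproutFn]
  exact isNewton_sproutFn _ _ rfl (fun n _ => by simp) n

theorem isNewton_esymm {N : ℕ} (n : ℕ) :
    IsNewton n (fun k => (-1 : K) ^ (k + 1)) (psumSeries K N)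
      fun k => ((MvPolynomial.esymm (Fin N) K k : MvPolynomial (Fin N) K) :
        MvPowerSeries (Fin N) K) := by
  intro k _
  have h : (k : K) • MvPolynomial.esymm (Fin N) K k = ∑ l ∈ Finset.Icc 1 k, (-1 : K) ^ (l + 1) •
      (MvPolynomial.psum (Fin N) K l * MvPolynomial.esymm (Fin N) K (k - l)) := by
    have h1 := MvPolynomial.mul_esymm_eq_sum (Fin N) K k
    rw [Nat.cast_smul_eq_nsmul, nsmul_eq_mul, h1, Finset.mul_sum]
    refine Finset.sum_nbij' (fun x => x.2) (fun l => (k - l, l)) ?_ ?_ ?_ ?_ ?_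
    · intro x hx
      simp at hx ⊢
      omega
    · intro l hl
      simp at hl ⊢
      omega
    · rintro ⟨x, y⟩ hx
      simp at hx ⊢
      omega
    · intro l _
      rfl
    · rintro ⟨x, y⟩ hx
      simp only [Finset.mem_filter, Finset.HasAntidiagonal.mem_antidiagonal] at hx
      obtain ⟨rfl, -⟩ := hx
      rw [Nat.add_sub_cancel, Algebra.smul_def, map_pow, map_neg, map_one]
      have : ((-1 : MvPolynomial (Fin N) K)) ^ (x + y + 1) * (-1) ^ x = (-1) ^ (y + 1) := by
        rw [← pow_add, show x + y + 1 + x = 2 * x + (y + 1) by ring, pow_add, pow_mul]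
        simp
      rw [← this]
      ring
  have h2 := congrArg (MvPolynomial.coeToMvPowerSeries.algHom (σ := Fin N) (R := K) K) h
  rw [map_smul, map_sum] at h2
  simpa [psumSeries] using h2

/-- The `k`-th generator of `K[y₁, …, y_N]`, with `y₀ = 1` and `yₖ = 0` for `k > N`. -/
def gen (K : Type*) [Field K] (N : ℕ) : ℕ → MvPolynomial (Fin N) K
  | 0 => 1
  | k + 1 => if h : k < N then MvPolynomial.X ⟨k, h⟩ else 0

/-- The algebra homomorphism `K[y₁, …, y_N] → K⟦x₁, …, x_N⟧` sending `yₖ` to `hₖ`. -/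
def hsymHom (K : Type*) [Field K] (N : ℕ) :
    MvPolynomial (Fin N) K →ₐ[K] MvPowerSeries (Fin N) K :=
  MvPolynomial.aeval fun m => restrictVars K N (hsym K (m + 1))

theorem restrictVars_hsym_zero (N : ℕ) : restrictVars K N (hsym K 0) = 1 := by
  rw [hsym_eq_sproutFn, restrictVars_sproutFn_zero _ rfl]

theorem hsymHom_gen {N k : ℕ} (hk : k ≤ N) :
    hsymHom K N (gen K N k) = restrictVars K N (hsym K k) := by
  cases k with
  | zero => rw [gen, map_one, restrictVars_hsym_zero]
  | succ k => rw [gen, dif_pos (Nat.lt_of_succ_le hk), hsymHom, MvPolynomial.aeval_X]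

theorem psumSeries_mem_range_hsymHom {N k : ℕ} (hk1 : 1 ≤ k) (hk : k ≤ N) :
    psumSeries K N k ∈ (hsymHom K N).range :=
  (isNewton_hsym N).mem_of_mem _ (restrictVars_hsym_zero N)
    (fun _ hl => (AlgHom.mem_range _).mpr ⟨_, hsymHom_gen hl⟩) k hk1 hk

theorem hsymHom_injective (N : ℕ) : Function.Injective (hsymHom K N) := by
  let ι : MvPolynomial (Fin N) K →ₐ[K] MvPowerSeries (Fin N) K :=
    MvPolynomial.coeToMvPowerSeries.algHom K
  have hι : ∀ q : MvPolynomial (Fin N) K, ι q = (q : MvPowerSeries (Fin N) K) := fun q => by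
    simp [ι]
  let f : MvPolynomial (Fin N) K →ₐ[K] MvPowerSeries (Fin N) K :=
    ι.comp ((Subalgebra.val _).comp (MvPolynomial.esymmAlgHom (Fin N) K N))
  have hfX : ∀ m : Fin N, f (MvPolynomial.X m) =
      (MvPolynomial.esymm (Fin N) K (m + 1) : MvPolynomial (Fin N) K) := fun m => by
    simp [f, hι, MvPolynomial.esymmAlgHom]
  have hf : Function.Injective f := by
    intro p q hpq
    have h1 : ι (MvPolynomial.esymmAlgHom (Fin N) K N p).val =
      ι (MvPolynomial.esymmAlgHom (Fin N) K N q).val := hpq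
    rw [hι, hι] at h1
    exact MvPolynomial.esymmAlgHom_fin_injective K le_rfl
      (Subtype.ext (MvPolynomial.coe_injective _ _ h1))
  have hpsum : ∀ k, psumSeries K N k ∈ f.range := fun k => by
    obtain ⟨q, hq⟩ := MvPolynomial.esymmAlgHom_fin_surjective K (le_refl N)
      ⟨MvPolynomial.psum (Fin N) K k, MvPolynomial.psum_isSymmetric (Fin N) K k⟩
    refine ⟨q, ?_⟩
    change ι (MvPolynomial.esymmAlgHom (Fin N) K N q).val = _
    rw [hq, hι]
    rfl
  refine injective_of_range_eq f _ hf (le_antisymm ?_ ?_)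
  · rintro _ ⟨q, rfl⟩
    have hE := (isNewton_esymm (K := K) (N := N) N).mem (hsymHom K N).range
      (by simp) fun k => psumSeries_mem_range_hsymHom
    induction q using MvPolynomial.induction_on with
    | C r => exact ⟨MvPolynomial.C r, by simp [← MvPolynomial.algebraMap_eq]⟩
    | add p q hp hq => simpa using Subalgebra.add_mem _ hp hq
    | mul_X p m hp =>
      have := Subalgebra.mul_mem _ hp (hE (m + 1) m.2)
      rw [← hfX m] at this
      simpa using this
  · rintro _ ⟨q, rfl⟩
    have hH := (isNewton_hsym (K := K) (N := N) N).mem f.range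
      (by simpa only [restrictVars_hsym_zero] using Subalgebra.one_mem _) fun k _ _ => hpsum k
    induction q using MvPolynomial.induction_on with
    | C r => exact ⟨MvPolynomial.C r, by simp [← MvPolynomial.algebraMap_eq]⟩
    | add p q hp hq => simpa using Subalgebra.add_mem _ hp hq
    | mul_X p m hp =>
      have := Subalgebra.mul_mem _ hp (hH (m + 1) m.2)
      rw [← hsymHom_gen m.2, gen, dif_pos m.2] at this
      simpa using this

theorem Multiset.pair_eq_pair_iff_or {α : Type*} {p q x y : α} :
    ({p, q} : Multiset α) = {x, y} ↔ (p = x ∧ q = y) ∨ (p = y ∧ q = x) := by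
  classical
  constructor
  · intro h
    have hp : p = x ∨ p = y := by
      have : p ∈ ({x, y} : Multiset α) := h ▸ by simp
      simpa using this
    rcases hp with rfl | rfl
    · left
      simpa [Multiset.insert_eq_cons] using h
    · right
      rw [Multiset.pair_comm x] at h
      simpa [Multiset.insert_eq_cons] using h
  · rintro (⟨rfl, rfl⟩ | ⟨rfl, rfl⟩)
    · rfl
    · exact Multiset.pair_comm _ _

section Taylor

open MvPolynomial

variable {σ : Type*} (s t : σ)

/-- The value at the origin of `∂f/∂yₛ`. -/
def linCoeff (f : MvPolynomial σ K) : K := constantCoeff (pderiv s f)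

/-- The value at the origin of `∂²f/∂yₛ∂yₜ`. -/
def quadCoeff (f : MvPolynomial σ K) : K := constantCoeff (pderiv s (pderiv t f))

theorem linCoeff_mul (f g : MvPolynomial σ K) :
    linCoeff s (f * g) = constantCoeff f * linCoeff s g + linCoeff s f * constantCoeff g := by
  simp [linCoeff, Derivation.leibniz, mul_comm]

theorem quadCoeff_mul (f g : MvPolynomial σ K) :
    quadCoeff s t (f * g) = constantCoeff f * quadCoeff s t g + linCoeff s f * linCoeff t g +
      linCoeff t f * linCoeff s g + quadCoeff s t f * constantCoeff g := by
  simp [linCoeff, quadCoeff, Derivation.leibniz]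
  ring

theorem linCoeff_sub (f g : MvPolynomial σ K) :
    linCoeff s (f - g) = linCoeff s f - linCoeff s g := by
  simp [linCoeff]

theorem quadCoeff_sub (f g : MvPolynomial σ K) :
    quadCoeff s t (f - g) = quadCoeff s t f - quadCoeff s t g := by
  simp [quadCoeff]

theorem linCoeff_smul (r : K) (f : MvPolynomial σ K) :
    linCoeff s (r • f) = r * linCoeff s f := by
  simp [linCoeff]

theorem quadCoeff_smul (r : K) (f : MvPolynomial σ K) :
    quadCoeff s t (r • f) = r * quadCoeff s t f := by
  simp [quadCoeff]

theorem linCoeff_sum {ι : Type*} (S : Finset ι) (f : ι → MvPolynomial σ K) :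
    linCoeff s (∑ x ∈ S, f x) = ∑ x ∈ S, linCoeff s (f x) := by
  simp [linCoeff]

theorem quadCoeff_sum {ι : Type*} (S : Finset ι) (f : ι → MvPolynomial σ K) :
    quadCoeff s t (∑ x ∈ S, f x) = ∑ x ∈ S, quadCoeff s t (f x) := by
  simp [quadCoeff]

end Taylor

section Generators

open MvPolynomial

variable {N : ℕ}

theorem constantCoeff_gen {k : ℕ} (hk : 1 ≤ k) : constantCoeff (gen K N k) = 0 := by
  obtain ⟨k, rfl⟩ := Nat.exists_eq_add_of_le' hk
  rw [gen]
  split_ifs <;> simp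

theorem linCoeff_gen (s : Fin N) (k : ℕ) :
    linCoeff s (gen K N k) = if k = s + 1 then 1 else 0 := by
  cases k with
  | zero => simp [linCoeff, gen]
  | succ k =>
    rw [gen, linCoeff]
    split_ifs with h1 h2 h2
    · have : s = ⟨k, h1⟩ := Fin.ext (by simp at h2 ⊢; omega)
      simp [this]
    · rw [pderiv_X_of_ne, map_zero]
      rintro rfl
      exact h2 rfl
    · have := s.2
      omega
    · simp

theorem quadCoeff_gen (s t : Fin N) (k : ℕ) : quadCoeff s t (gen K N k) = 0 := by
  cases k with
  | zero => simp [quadCoeff, gen]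
  | succ k =>
    rw [gen, quadCoeff]
    split_ifs with h1
    · rw [pderiv_X]
      rcases eq_or_ne (⟨k, h1⟩ : Fin N) t with h | h
      · simp [h]
      · simp [h]
    · simp

theorem quadCoeff_prod_gen (s t : Fin N) (μ : Multiset ℕ) (hμ : ∀ k ∈ μ, 0 < k) :
    quadCoeff s t (μ.map (gen K N)).prod =
      if μ = {(s : ℕ) + 1, (t : ℕ) + 1} then (if s = t then 2 else 1) else 0 := by
  induction μ using Multiset.induction_on with
  | empty =>
    rw [if_neg (by simp)]
    simp [quadCoeff]
  | cons p μ _ =>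
    induction μ using Multiset.induction_on with
    | empty =>
      rw [if_neg fun h => by simpa using congrArg Multiset.card h]
      simpa using quadCoeff_gen s t p
    | cons q ν _ =>
      have hp := constantCoeff_gen (K := K) (N := N) (hμ p (by simp))
      have hq := constantCoeff_gen (K := K) (N := N) (hμ q (by simp))
      simp only [Multiset.map_cons, Multiset.prod_cons, quadCoeff_mul, linCoeff_mul, map_mul, hp, hq,
        quadCoeff_gen, linCoeff_gen]
      induction ν using Multiset.induction_on with
      | empty =>
        have : p ::ₘ q ::ₘ (0 : Multiset ℕ) = {(s : ℕ) + 1, (t : ℕ) + 1} ↔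
            (p = s + 1 ∧ q = t + 1) ∨ (p = t + 1 ∧ q = s + 1) := by
          exact Multiset.pair_eq_pair_iff_or
        simp only [this, Fin.ext_iff, Multiset.map_zero, Multiset.prod_zero, map_one]
        split_ifs <;> first | omega | norm_num
      | cons r ν _ =>
        rw [if_neg (c := p ::ₘ q ::ₘ r ::ₘ ν = _)]
        · have hr := constantCoeff_gen (K := K) (N := N) (hμ r (by simp))
          simp [hr]
        · intro h
          simpa using congrArg Multiset.card h

variable {b : ℕ → K} {P R : ℕ → MvPolynomial (Fin N) K}

theorem constantCoeff_psum (hP : IsNewton N (fun _ => (1 : K)) P (gen K N)) {k : ℕ} (hk1 : 1 ≤ k)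
    (hk : k ≤ N) : constantCoeff (P k) = 0 := by
  have h := hP.eq_sub rfl hk1 hk
  rw [one_smul] at h
  rw [h, map_sub, map_sum, smul_eq_C_mul, map_mul, constantCoeff_gen hk1, mul_zero, zero_sub,
    neg_eq_zero]
  refine Finset.sum_eq_zero fun l hl => ?_
  rw [Finset.mem_Ico] at hl
  rw [one_smul, map_mul, constantCoeff_gen (by omega), mul_zero]

theorem linCoeff_psum (hP : IsNewton N (fun _ => (1 : K)) P (gen K N)) (s : Fin N) {k : ℕ}
    (hk1 : 1 ≤ k) (hk : k ≤ N) : linCoeff s (P k) = if k = s + 1 then (k : K) else 0 := by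
  have h := hP.eq_sub rfl hk1 hk
  rw [one_smul] at h
  rw [h, linCoeff_sub, linCoeff_sum, linCoeff_smul, linCoeff_gen, Finset.sum_eq_zero]
  · simp
  · intro l hl
    rw [Finset.mem_Ico] at hl
    rw [one_smul, linCoeff_mul, constantCoeff_gen (by omega),
      constantCoeff_psum hP hl.1 (by omega)]
    simp

theorem quadCoeff_psum (hP : IsNewton N (fun _ => (1 : K)) P (gen K N)) (s t : Fin N)
    (hst : (s : ℕ) + 1 + (t + 1) = N) : quadCoeff s t (P N) = -N := by
  have h := hP.eq_sub rfl (by omega) le_rfl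
  rw [one_smul] at h
  rw [h, quadCoeff_sub, quadCoeff_sum, quadCoeff_smul, quadCoeff_gen]
  have hterm : ∀ l ∈ Finset.Ico 1 N, quadCoeff s t ((1 : K) • (P l * gen K N (N - l))) =
      (if l = s + 1 then (l : K) else 0) + (if l = t + 1 then (l : K) else 0) := by
    intro l hl
    rw [Finset.mem_Ico] at hl
    rw [one_smul, quadCoeff_mul, constantCoeff_gen (by omega), quadCoeff_gen, linCoeff_gen,
      linCoeff_gen, linCoeff_psum hP s hl.1 hl.2.le, linCoeff_psum hP t hl.1 hl.2.le]
    simp only [show N - l = (t : ℕ) + 1 ↔ l = s + 1 by omega,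
      show N - l = (s : ℕ) + 1 ↔ l = t + 1 by omega]
    split_ifs <;> ring
  rw [Finset.sum_congr rfl hterm, Finset.sum_add_distrib, Finset.sum_ite_eq', Finset.sum_ite_eq',
    if_pos (Finset.mem_Ico.mpr (by omega)), if_pos (Finset.mem_Ico.mpr (by omega)),
    ← Nat.cast_add, hst]
  simp

theorem constantCoeff_newton (hP : IsNewton N (fun _ => (1 : K)) P (gen K N))
    (hR : IsNewton N b P R) {k : ℕ} (hk1 : 1 ≤ k) (hk : k ≤ N) : constantCoeff (R k) = 0 := by
  have h := congrArg constantCoeff (hR k hk)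
  rw [map_sum, Finset.sum_eq_zero, smul_eq_C_mul, map_mul, constantCoeff_C] at h
  · exact (mul_eq_zero.mp h).resolve_left (Nat.cast_ne_zero.mpr (by omega))
  · intro l hl
    rw [Finset.mem_Icc] at hl
    rw [smul_eq_C_mul, map_mul, map_mul, constantCoeff_psum hP hl.1 (by omega)]
    simp

theorem sum_Icc_one_eq_add_sum_Ico {k : ℕ} (hk1 : 1 ≤ k) (f : ℕ → K) :
    ∑ l ∈ Finset.Icc 1 k, f l = ∑ l ∈ Finset.Ico 1 k, f l + f k := by
  rw [← Finset.Ico_succ_right_eq_Icc, Order.succ_eq_add_one, Finset.sum_Ico_succ_top hk1]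

theorem linCoeff_newton (hP : IsNewton N (fun _ => (1 : K)) P (gen K N))
    (hR : IsNewton N b P R) (hR0 : R 0 = 1) (s : Fin N) {k : ℕ} (hk1 : 1 ≤ k) (hk : k ≤ N) :
    linCoeff s (R k) = if k = s + 1 then b k else 0 := by
  have h := congrArg (linCoeff s) (hR k hk)
  rw [linCoeff_sum, linCoeff_smul, sum_Icc_one_eq_add_sum_Ico hk1, Finset.sum_eq_zero,
    linCoeff_smul, linCoeff_mul, Nat.sub_self, hR0, linCoeff_psum hP s hk1 hk,
    constantCoeff_psum hP hk1 hk] at h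
  · have hk0 : (k : K) ≠ 0 := Nat.cast_ne_zero.mpr (by omega)
    apply mul_left_cancel₀ hk0
    rw [h]
    split_ifs <;> simp [mul_comm]
  · intro l hl
    rw [Finset.mem_Ico] at hl
    rw [linCoeff_smul, linCoeff_mul, constantCoeff_psum hP hl.1 (by omega),
      constantCoeff_newton hP hR (by omega) (by omega)]
    simp

theorem quadCoeff_newton (hP : IsNewton N (fun _ => (1 : K)) P (gen K N))
    (hR : IsNewton N b P R) (hR0 : R 0 = 1) (s t : Fin N) (hst : (s : ℕ) + 1 + (t + 1) = N) :
    quadCoeff s t (R N) = b (s + 1) * b (t + 1) - b N := by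
  have hN : 1 ≤ N := by omega
  have h := congrArg (quadCoeff s t) (hR N le_rfl)
  have hterm : ∀ l ∈ Finset.Ico 1 N, quadCoeff s t (b l • (P l * R (N - l))) =
      (if l = s + 1 then (l : K) * (b l * b (N - l)) else 0) +
        (if l = t + 1 then (l : K) * (b l * b (N - l)) else 0) := by
    intro l hl
    rw [Finset.mem_Ico] at hl
    rw [quadCoeff_smul, quadCoeff_mul, constantCoeff_psum hP hl.1 hl.2.le,
      constantCoeff_newton hP hR (by omega) (by omega),
      linCoeff_newton hP hR hR0 s (by omega) (by omega),
      linCoeff_newton hP hR hR0 t (by omega) (by omega),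
      linCoeff_psum hP s hl.1 hl.2.le, linCoeff_psum hP t hl.1 hl.2.le]
    simp only [show N - l = (t : ℕ) + 1 ↔ l = s + 1 by omega,
      show N - l = (s : ℕ) + 1 ↔ l = t + 1 by omega]
    split_ifs <;> ring
  rw [quadCoeff_sum, quadCoeff_smul, sum_Icc_one_eq_add_sum_Ico hN, Finset.sum_congr rfl hterm,
    Finset.sum_add_distrib, Finset.sum_ite_eq', Finset.sum_ite_eq',
    if_pos (Finset.mem_Ico.mpr (by omega)), if_pos (Finset.mem_Ico.mpr (by omega)),
    Nat.sub_self, hR0, mul_one, quadCoeff_smul, quadCoeff_psum hP s t hst,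
    show N - ((s : ℕ) + 1) = t + 1 by omega, show N - ((t : ℕ) + 1) = s + 1 by omega] at h
  have hN0 : (N : K) ≠ 0 := Nat.cast_ne_zero.mpr (by omega)
  have hcast : (N : K) = ((s : ℕ) + 1 : ℕ) + ((t : ℕ) + 1 : ℕ) := by
    rw [← Nat.cast_add, hst]
  apply mul_left_cancel₀ hN0
  rw [h, mul_sub]
  linear_combination -(b (s + 1) * b (t + 1)) * hcast

end Generators

/-- The second-order coefficients of the expression of `R_N` as a polynomial in the `hₖ`. -/
theorem quadCoeff_of_hsymHom_eq (a b : ℕ → K) (ha0 : a 0 = 1)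
    (hb : ∀ n : ℕ, 1 ≤ n → (n : K) * a n = ∑ k ∈ Finset.Icc 1 n, b k * a (n - k))
    {N : ℕ} (s t : Fin N) (hst : (s : ℕ) + 1 + (t + 1) = N) (q : MvPolynomial (Fin N) K)
    (hq : hsymHom K N q = restrictVars K N (sproutFn a N)) :
    quadCoeff s t q = b (s + 1) * b (t + 1) - b N := by
  have hinj := hsymHom_injective (K := K) N
  have hPex : ∀ k, ∃ p, 1 ≤ k → k ≤ N → hsymHom K N p = psumSeries K N k := fun k => by
    by_cases hk : 1 ≤ k ∧ k ≤ N
    · obtain ⟨p, hp⟩ := psumSeries_mem_range_hsymHom (K := K) hk.1 hk.2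
      exact ⟨p, fun _ _ => hp⟩
    · exact ⟨0, fun h1 h2 => absurd ⟨h1, h2⟩ hk⟩
  choose P hP using hPex
  have hsp := isNewton_sproutFn (N := N) a b ha0 hb N
  have hmem := hsp.mem (hsymHom K N).range
    (by simpa only [restrictVars_sproutFn_zero a ha0] using Subalgebra.one_mem _)
    fun k => psumSeries_mem_range_hsymHom
  have hRex : ∀ k, ∃ r, k ≤ N → hsymHom K N r = restrictVars K N (sproutFn a k) := fun k => by
    by_cases hk : k ≤ N
    · obtain ⟨r, hr⟩ := hmem k hk
      exact ⟨r, fun _ => hr⟩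
    · exact ⟨0, fun h => absurd h hk⟩
  choose R hR using hRex
  have hR0 : R 0 = 1 := hinj (by
    rw [hR 0 (Nat.zero_le N), restrictVars_sproutFn_zero a ha0, map_one])
  have hqR : q = R N := hinj (by rw [hq, hR N le_rfl])
  rw [hqR]
  exact quadCoeff_newton
    (isNewton_of_injective (isNewton_hsym N) _ hinj hP fun k hk => hsymHom_gen hk)
    (isNewton_of_injective hsp _ hinj hP hR) hR0 s t hst

theorem hsymHom_prod_gen {N : ℕ} (l : Nat.Partition N) :
    hsymHom K N (l.parts.map (gen K N)).prod = restrictVars K N (hprod K l.parts) := by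
  rw [hprod, map_multiset_prod, map_multiset_prod, Multiset.map_map, Multiset.map_map]
  refine congrArg Multiset.prod (Multiset.map_congr rfl fun k hk => ?_)
  exact hsymHom_gen (by simpa [l.parts_sum] using Multiset.le_sum_of_mem hk)

/-- With `log F(t) = ∑ bₙ tⁿ/n` and `i + j = n` (`i, j ≥ 1`),
the coefficient of `hᵢhⱼ` in the `h`-expansion of `Rₙ` is `bᵢbⱼ - bₙ` when
`i ≠ j`, and `(bᵢ² - bₙ)/2` when `i = j`. -/
theorem statement13 (a b : ℕ → K) (ha0 : a 0 = 1)
    (hb : ∀ n : ℕ, 1 ≤ n → (n : K) * a n = ∑ k ∈ Finset.Icc 1 n, b k * a (n - k))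
    (i j : ℕ) (hi : 0 < i) (hj : 0 < j) (c : Nat.Partition (i + j) → K)
    (hc : sproutFn a (i + j) =
      ∑ l : Nat.Partition (i + j), c l • hprod K l.parts) :
    (i ≠ j → c (twoPartition i j hi hj) = b i * b j - b (i + j)) ∧
    (i = j → c (twoPartition i j hi hj) = (b i ^ 2 - b (i + j)) / 2) := by
  obtain ⟨s, rfl⟩ := Nat.exists_eq_add_of_le' hi
  obtain ⟨t, rfl⟩ := Nat.exists_eq_add_of_le' hj
  let s' : Fin (s + 1 + (t + 1)) := ⟨s, by omega⟩
  let t' : Fin (s + 1 + (t + 1)) := ⟨t, by omega⟩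
  have hparts : (twoPartition (s + 1) (t + 1) hi hj).parts = {(s' : ℕ) + 1, (t' : ℕ) + 1} := rfl
  have hmain := quadCoeff_of_hsymHom_eq a b ha0 hb s' t' rfl
    (∑ l : Nat.Partition (s + 1 + (t + 1)), c l • (l.parts.map (gen K _)).prod) (by
      rw [hc, map_sum, map_sum]
      refine Finset.sum_congr rfl fun l _ => ?_
      rw [map_smul, map_smul, hsymHom_prod_gen])
  rw [quadCoeff_sum, Finset.sum_eq_single (twoPartition (s + 1) (t + 1) hi hj),
    quadCoeff_smul, quadCoeff_prod_gen s' t' _ (fun _ hk => Nat.Partition.parts_pos _ hk),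
    if_pos hparts] at hmain
  · refine ⟨fun hne => ?_, fun heq => ?_⟩
    · rwa [if_neg (by simpa [s', t'] using hne), mul_one] at hmain
    · obtain rfl : s = t := by omega
      rw [if_pos rfl] at hmain
      rw [eq_div_iff two_ne_zero, hmain, sq]
  · intro l _ hl
    rw [quadCoeff_smul, quadCoeff_prod_gen s' t' _ (fun _ hk => l.parts_pos hk), if_neg, mul_zero]
    exact fun h => hl (Nat.Partition.ext h)
  · exact fun h => absurd (Finset.mem_univ _) h

end
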